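/- Let n ≥ 1, s ∈ (1/2,1), 0 ≤ R₀ < R, Ω = A_{R₀,R}, and let f : [0,∞) → ℝ be continuously differentiable with f ≥ 0. Let u ∈ H^s_{Ω,0} be radial, essentially bounded on Ω, with u ≥ 0 a.e. in Ω, and a weak solution of (−Δ)^s u + u = f(u) in Ω with 𝒩_s u = 0 in ℝⁿ ∖ cl(Ω). If f'(t) < λ₂^{rad}(Ω) + 1 for every t ∈ [0, ess sup_Ω u], then u is a.e. equal to a constant in Ω. -/

import Mathlib

open MeasureTheory Filter Set

noncomputable section

/-- Euclidean space ℝⁿ. -/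
abbrev En (n : ℕ) : Type := EuclideanSpace ℝ (Fin n)

/-- The annulus `A_{R₀,R} = {x : R₀ < |x| < R}`, understood as the ball `B_R` when `R₀ = 0`. -/
def annR (n : ℕ) (R₀ R : ℝ) : Set (En n) :=
  if R₀ = 0 then Metric.ball (0 : En n) R else {x : En n | R₀ < ‖x‖ ∧ ‖x‖ < R}

/-- The region `ℝ^{2n} ∖ (Ωᶜ × Ωᶜ)`: pairs (x,y) not both outside Ω. -/
def crossSet {n : ℕ} (Ω : Set (En n)) : Set (En n × En n) :=
  {p : En n × En n | p.1 ∈ Ω ∨ p.2 ∈ Ω}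

/-- Gagliardo integrand `|u(x) - u(y)|² / |x-y|^{n+2s}`. -/
def gagSq {n : ℕ} (s : ℝ) (u : En n → ℝ) (p : En n × En n) : ℝ :=
  |u p.1 - u p.2| ^ 2 / dist p.1 p.2 ^ ((n : ℝ) + 2 * s)

/-- Bilinear Gagliardo integrand `(u(x)-u(y))(v(x)-v(y)) / |x-y|^{n+2s}`. -/
def gagBil {n : ℕ} (s : ℝ) (u v : En n → ℝ) (p : En n × En n) : ℝ :=
  (u p.1 - u p.2) * (v p.1 - v p.2) / dist p.1 p.2 ^ ((n : ℝ) + 2 * s)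

/-- Membership in `H^s_{Ω,0}`. -/
def MemHs {n : ℕ} (s : ℝ) (Ω : Set (En n)) (u : En n → ℝ) : Prop :=
  Measurable u ∧ IntegrableOn (fun x => (u x) ^ 2) Ω ∧
    IntegrableOn (gagSq s u) (crossSet Ω)

/-- Square of the seminorm `[u]_{H^s_{Ω,0}}²`. -/
def seminormSq {n : ℕ} (c s : ℝ) (Ω : Set (En n)) (u : En n → ℝ) : ℝ :=
  (c / 2) * ∫ p in crossSet Ω, gagSq s u p

/-- The norm `‖u‖_{H^s_{Ω,0}} = ‖u‖_{L²(Ω)} + [u]_{H^s_{Ω,0}}`. -/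
def HsNorm {n : ℕ} (c s : ℝ) (Ω : Set (En n)) (u : En n → ℝ) : ℝ :=
  (∫ x in Ω, (u x) ^ 2) ^ (1/2 : ℝ) + (seminormSq c s Ω u) ^ (1/2 : ℝ)

/-- `u ∈ H^s_{Ω,0}` is a weak solution of the linear Neumann problem
`(-Δ)ˢ u + u = h` in Ω, `𝒩ₛ u = 0` outside. -/
def SolvesLin {n : ℕ} (c s : ℝ) (Ω : Set (En n)) (h u : En n → ℝ) : Prop :=
  MemHs s Ω u ∧ ∀ v : En n → ℝ, MemHs s Ω v →
    IntegrableOn (gagBil s u v) (crossSet Ω) ∧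
    IntegrableOn (fun x => u x * v x) Ω ∧
    IntegrableOn (fun x => h x * v x) Ω ∧
    (c / 2) * (∫ p in crossSet Ω, gagBil s u v p) + ∫ x in Ω, u x * v x
      = ∫ x in Ω, h x * v x

/-- Weak solution of the nonlinear Neumann problem `(-Δ)ˢ u + u = g(u)`, `u ≥ 0`. -/
def IsWeakSolution {n : ℕ} (c s : ℝ) (Ω : Set (En n)) (g : ℝ → ℝ) (u : En n → ℝ) : Prop :=
  (∀ᵐ x ∂(volume.restrict Ω), 0 ≤ u x) ∧ SolvesLin c s Ω (fun x => g (u x)) u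

/-- `u` is radial with profile `φ`. -/
def IsRadialWith {n : ℕ} (u : En n → ℝ) (φ : ℝ → ℝ) : Prop :=
  ∀ x : En n, u x = φ ‖x‖

/-- The cone `𝒞₊` of non-negative, radial, radially non-decreasing functions in `H^s_{Ω,0}`. -/
def InConePlus {n : ℕ} (s R₀ R : ℝ) (Ω : Set (En n)) (u : En n → ℝ) : Prop :=
  MemHs s Ω u ∧ (∀ x, 0 ≤ u x) ∧
    ∃ φ : ℝ → ℝ, IsRadialWith u φ ∧ MonotoneOn φ (Icc R₀ R)

/-- The cone `𝒞₋` of non-negative, radial, radially non-increasing functions in `H^s_{Ω,0}`. -/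
def InConeMinus {n : ℕ} (s R₀ R : ℝ) (Ω : Set (En n)) (u : En n → ℝ) : Prop :=
  MemHs s Ω u ∧ (∀ x, 0 ≤ u x) ∧
    ∃ φ : ℝ → ℝ, IsRadialWith u φ ∧ AntitoneOn φ (Icc R₀ R)

/-- The second radial increasing eigenvalue `λ₂^{+,r}(Ω)`. -/
def lambda2plusr {n : ℕ} (c s R₀ R : ℝ) (Ω : Set (En n)) : ℝ :=
  sInf { t : ℝ | ∃ (v : En n → ℝ) (φ : ℝ → ℝ), MemHs s Ω v ∧ IsRadialWith v φ ∧
    MonotoneOn φ (Icc R₀ R) ∧ (∫ x in Ω, v x) = 0 ∧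
    ¬ (∀ᵐ x ∂(volume.restrict Ω), v x = 0) ∧
    t = seminormSq c s Ω v / ∫ x in Ω, (v x) ^ 2 }

/-- The second radial eigenvalue `λ₂^{rad}(Ω)`. -/
def lambda2rad {n : ℕ} (c s : ℝ) (Ω : Set (En n)) : ℝ :=
  sInf { t : ℝ | ∃ (v : En n → ℝ) (φ : ℝ → ℝ), MemHs s Ω v ∧ IsRadialWith v φ ∧
    (∫ x in Ω, v x) = 0 ∧ ¬ (∀ᵐ x ∂(volume.restrict Ω), v x = 0) ∧
    t = seminormSq c s Ω v / ∫ x in Ω, (v x) ^ 2 }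

/-- The energy functional associated with the truncated problem, with `F̃(t) = ∫₀ᵗ f̃`. -/
def energy {n : ℕ} (c s : ℝ) (Ω : Set (En n)) (ftil : ℝ → ℝ) (u : En n → ℝ) : ℝ :=
  (c / 4) * (∫ p in crossSet Ω, gagSq s u p) + (1/2) * (∫ x in Ω, (u x) ^ 2)
    - ∫ x in Ω, (∫ τ in (0:ℝ)..(u x), ftil τ)

/-- The derivative of the energy functional: `E'(u)[v]`. -/
def Eprime {n : ℕ} (c s : ℝ) (Ω : Set (En n)) (ftil : ℝ → ℝ) (u v : En n → ℝ) : ℝ :=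
  (c / 2) * (∫ p in crossSet Ω, gagBil s u v p) + (∫ x in Ω, u x * v x)
    - ∫ x in Ω, ftil (u x) * v x


theorem seminormSq_nonneg {n : ℕ} {c s : ℝ} (hc : 0 ≤ c) (Ω : Set (En n)) (u : En n → ℝ) :
    0 ≤ seminormSq c s Ω u :=
  mul_nonneg (by positivity) (integral_nonneg fun p => by
    simp only [gagSq, Pi.zero_apply]; positivity)

theorem gagSq_sub_const {n : ℕ} (s : ℝ) (u : En n → ℝ) (k : ℝ) :
    gagSq s (fun x => u x - k) = gagSq s u := by
  ext p
  simp [gagSq]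

theorem gagBil_sub_const {n : ℕ} (s : ℝ) (u : En n → ℝ) (k : ℝ) :
    gagBil s u (fun x => u x - k) = gagSq s u := by
  ext p
  simp [gagSq, gagBil, sq]

theorem memHs_const {n : ℕ} (s : ℝ) {Ω : Set (En n)} (hΩ : volume Ω ≠ ⊤) (k : ℝ) :
    MemHs s Ω (fun _ => k) := by
  refine ⟨measurable_const, integrableOn_const hΩ, ?_⟩
  have : gagSq s (fun _ : En n => k) = 0 := by
    ext p
    simp [gagSq]
  rw [this]
  exact integrableOn_zero

theorem volume_annR_ne_top (n : ℕ) (R₀ R : ℝ) : volume (annR n R₀ R) ≠ ⊤ := by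
  refine ((measure_mono ?_).trans_lt (measure_ball_lt_top (x := (0 : En n)) (r := R))).ne
  intro x hx
  unfold annR at hx
  split_ifs at hx
  · exact hx
  · simpa using hx.2

theorem lambda2rad_mul_le {n : ℕ} {c s : ℝ} (hc : 0 ≤ c) {Ω : Set (En n)} {v : En n → ℝ}
    {φ : ℝ → ℝ} (hv : MemHs s Ω v) (hφ : IsRadialWith v φ) (hmean : ∫ x in Ω, v x = 0)
    (hne : ¬ ∀ᵐ x ∂(volume.restrict Ω), v x = 0) :
    lambda2rad c s Ω * ∫ x in Ω, (v x) ^ 2 ≤ seminormSq c s Ω v := by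
  have hnn : 0 ≤ ∫ x in Ω, (v x) ^ 2 := integral_nonneg fun x => sq_nonneg _
  have hpos : 0 < ∫ x in Ω, (v x) ^ 2 := by
    refine lt_of_le_of_ne hnn fun h => hne ?_
    have h0 := (integral_eq_zero_iff_of_nonneg (fun x => sq_nonneg (v x)) hv.2.1).1 h.symm
    filter_upwards [h0] with x hx
    simpa using hx
  rw [← le_div_iff₀ hpos]
  refine csInf_le ⟨0, ?_⟩ ⟨v, φ, hv, hφ, hmean, hne, rfl⟩
  rintro t ⟨w, _, _, _, _, _, rfl⟩
  exact div_nonneg (seminormSq_nonneg hc Ω w) (integral_nonneg fun x => sq_nonneg _)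

theorem sub_mul_sub_lt_of_deriv_lt {f f' : ℝ → ℝ} {M L a b : ℝ}
    (hdiff : ∀ t ∈ Ici (0:ℝ), HasDerivWithinAt f (f' t) (Ici 0) t)
    (hlt : ∀ t ∈ Icc 0 M, f' t < L) (ha : a ∈ Icc 0 M) (hb : b ∈ Icc 0 M) (hab : a ≠ b) :
    (f a - f b) * (a - b) < L * (a - b) ^ 2 := by
  wlog h : a < b generalizing a b
  · have := this hb ha hab.symm (lt_of_le_of_ne (not_lt.1 h) hab.symm)
    linarith
  have hcont : ContinuousOn f (Icc a b) := fun t ht =>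
    ((hdiff t (ha.1.trans ht.1)).continuousWithinAt).mono fun y hy => ha.1.trans hy.1
  obtain ⟨t, ht, hslope⟩ := exists_hasDerivAt_eq_slope f f' h hcont fun t ht =>
    (hdiff t (ha.1.trans ht.1.le)).hasDerivAt (Ici_mem_nhds (ha.1.trans_lt ht.1))
  have hL := hlt t ⟨ha.1.trans ht.1.le, ht.2.le.trans hb.2⟩
  rw [hslope, div_lt_iff₀ (sub_pos.2 h)] at hL
  nlinarith [mul_lt_mul_of_pos_right hL (sub_pos.2 h)]

/-- if `f' < λ₂^{rad}(Ω) + 1` on the range of `u`, every bounded radial weak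
solution is constant a.e. in `Ω`. -/
theorem statement16 {n : ℕ} (hn : 1 ≤ n) {s c R₀ R : ℝ}
    (hs : s ∈ Ioo (1/2 : ℝ) 1) (hc : 0 < c) (hR₀ : 0 ≤ R₀) (hR : R₀ < R)
    (Ω : Set (En n)) (hΩ : Ω = annR n R₀ R)
    (f f' : ℝ → ℝ)
    (hdiff : ∀ t ∈ Ici (0:ℝ), HasDerivWithinAt f (f' t) (Ici 0) t)
    (hcont : ContinuousOn f' (Ici 0))
    (hnonneg : ∀ t ∈ Ici (0:ℝ), 0 ≤ f t)
    (u : En n → ℝ) (φ : ℝ → ℝ) (hrad : IsRadialWith u φ)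
    (hmem : MemHs s Ω u)
    (hbdd : ∃ C : ℝ, ∀ᵐ x ∂(volume.restrict Ω), |u x| ≤ C)
    (hsol : IsWeakSolution c s Ω f u)
    (hsmall : ∀ t ∈ Icc (0:ℝ) (essSup u (volume.restrict Ω)),
      f' t < lambda2rad c s Ω + 1) :
    ∃ k : ℝ, ∀ᵐ x ∂(volume.restrict Ω), u x = k := by
  obtain ⟨hu0, -, hweak⟩ := hsol
  have hfin : volume Ω ≠ ⊤ := hΩ ▸ volume_annR_ne_top n R₀ R
  have : IsFiniteMeasure (volume.restrict Ω) := isFiniteMeasure_restrict.2 hfin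
  set μ := volume.restrict Ω with hμ
  rcases eq_or_ne μ 0 with hzero | hμ0
  · exact ⟨0, by simp [hzero]⟩
  have : NeZero μ := ⟨hμ0⟩
  obtain ⟨C, hC⟩ := hbdd
  have huM : ∀ᵐ x ∂μ, u x ≤ essSup u μ :=
    ae_le_essSup (isBoundedUnder_of_eventually_le (a := C)
      (hC.mono fun x hx => (le_abs_self _).trans hx))
  obtain ⟨-, hint1, -, -⟩ := hweak _ (memHs_const s hfin 1)
  have huint : Integrable u μ := by simpa [IntegrableOn] using hint1
  set k := ⨍ x, u x ∂μ
  have hkmem : k ∈ Icc 0 (essSup u μ) :=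
    (convex_Icc 0 (essSup u μ)).average_mem isClosed_Icc
      (by filter_upwards [hu0, huM] with x h0 h1 using ⟨h0, h1⟩) huint
  refine ⟨k, ?_⟩
  set v : En n → ℝ := fun x => u x - k with hv
  have hmean : ∫ x, v x ∂μ = 0 := integral_sub_average μ u
  by_contra hne
  have hvne : ¬ ∀ᵐ x ∂μ, v x = 0 := by simpa [hv, sub_eq_zero] using hne
  have hvint : Integrable v μ := huint.sub (integrable_const k)
  have hv2 : Integrable (fun x => v x ^ 2) μ := by
    have h := (hmem.2.1.sub (huint.const_mul (2 * k))).add (integrable_const (k ^ 2))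
    refine h.congr (ae_of_all _ fun x => ?_)
    simp only [hv, Pi.add_apply, Pi.sub_apply]
    ring
  have hvmem : MemHs s Ω v :=
    ⟨hmem.1.sub_const k, hv2, by rw [hv, gagSq_sub_const]; exact hmem.2.2⟩
  have hlam := lambda2rad_mul_le hc.le hvmem (φ := fun r => φ r - k)
    (fun x => by simp [hv, hrad x]) hmean hvne
  obtain ⟨-, -, hfv, heq⟩ := hweak v hvmem
  change Integrable (fun x => f (u x) * v x) μ at hfv
  simp only [← hμ] at heq hlam
  have hsemi : (c / 2) * (∫ p in crossSet Ω, gagBil s u v p) = seminormSq c s Ω v := by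
    simp only [seminormSq, hv, gagBil_sub_const, gagSq_sub_const]
  have huv : ∫ x, u x * v x ∂μ = ∫ x, v x ^ 2 ∂μ := by
    have h : ∀ x, u x * v x = v x ^ 2 + k * v x := fun x => by simp only [hv]; ring
    simp_rw [h]
    rw [integral_add hv2 (hvint.const_mul k), integral_const_mul, hmean]
    ring
  have hdint : Integrable (fun x => (f (u x) - f k) * v x) μ := by
    simp_rw [sub_mul]
    exact Integrable.sub hfv (hvint.const_mul (f k))
  have hfeq : ∫ x, (f (u x) - f k) * v x ∂μ = ∫ x, f (u x) * v x ∂μ := by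
    simp_rw [sub_mul]
    rw [integral_sub hfv (hvint.const_mul (f k)), integral_const_mul, hmean]
    ring
  have hstrict : ∀ᵐ x ∂μ, v x ≠ 0 →
      (f (u x) - f k) * v x < (lambda2rad c s Ω + 1) * v x ^ 2 := by
    filter_upwards [hu0, huM] with x h0 h1 hx
    exact sub_mul_sub_lt_of_deriv_lt hdiff hsmall ⟨h0, h1⟩ hkmem (sub_ne_zero.1 hx)
  set w : En n → ℝ := fun x => (lambda2rad c s Ω + 1) * v x ^ 2 - (f (u x) - f k) * v x with hw
  have hwint : Integrable w μ := (hv2.const_mul _).sub hdint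
  have hw0 : 0 ≤ᵐ[μ] w := by
    filter_upwards [hstrict] with x hx
    by_cases h : v x = 0
    · simp [hw, h]
    · exact (sub_pos.2 (hx h)).le
  have hwle : ∫ x, w x ∂μ ≤ 0 := by
    rw [hw, integral_sub (hv2.const_mul _) hdint, integral_const_mul, hfeq]
    linarith
  have hwz := (integral_eq_zero_iff_of_nonneg_ae hw0 hwint).1
    (le_antisymm hwle (integral_nonneg_of_ae hw0))
  refine hvne ?_
  filter_upwards [hwz, hstrict] with x hx hs'
  by_contra h
  exact (sub_pos.2 (hs' h)).ne' hx

end
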